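/- arXiv:2506.04530 — 2 statements merged into one kernel-verified Lean document; each statement's English description precedes it below -/
import Mathlib

section
/- Let φ be an inner product on the noise subspace 𝒩. Then the following conditions are equivalent: (i) φ is the 𝒞-decoding inner product on 𝒩; (ii) ⟨N u, M v⟩ = φ(N,M) ⟨u,v⟩ for all N, M ∈ 𝒩 and all u, v ∈ 𝒞; (iii) φ(N,M) = tr(ρ N* M) for every state ρ supported in 𝒞 and all N, M ∈ 𝒩, and ⟨N u, M v⟩ = 0 whenever u, v ∈ 𝒞 with u ⊥ v; (iv) P_F N* M P_F = φ(N,M) P_F for every subspace F ⊆ 𝒞 (P_F the orthogonal projection onto F) and all N, M ∈ 𝒩; (v) for every nonzero N ∈ 𝒩 and every subspace F ⊆ 𝒞, the operator φ(N,N)^{-1/2} N P_F is a partial isometry onto F. -/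
open scoped InnerProductSpace ComplexConjugate ComplexOrder
open LinearMap Submodule

noncomputable section

variable {H : Type} [NormedAddCommGroup H] [InnerProductSpace ℂ H] [FiniteDimensional ℂ H]

/-- The support of an operator. -/
def supp (T : H →ₗ[ℂ] H) : Submodule ℂ H := (LinearMap.ker T)ᗮ

/-- The orthogonal projection onto a subspace, as an operator on `H`. -/
def projOf (C : Submodule ℂ H) : H →ₗ[ℂ] H :=
  C.subtype ∘ₗ (orthogonalProjection C).toLinearMap

/-- `V` is a partial isometry. -/
def IsPartialIsometry (V : H →ₗ[ℂ] H) : Prop :=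
  LinearMap.adjoint V ∘ₗ V = projOf (supp V)

/-- `V` is a partial isometry onto `F`. -/
def IsPartialIsometryOnto (V : H →ₗ[ℂ] H) (F : Submodule ℂ H) : Prop :=
  IsPartialIsometry V ∧ supp V = F

/-- A state supported in `C`. -/
def IsStateOn (C : Submodule ℂ H) (ρ : H →ₗ[ℂ] H) : Prop :=
  LinearMap.adjoint ρ = ρ ∧ (∀ x : H, 0 ≤ ⟪x, ρ x⟫_ℂ) ∧
    LinearMap.trace ℂ H ρ = 1 ∧ supp ρ ≤ C

/-- A sesquilinear form (antilinear in the first argument). -/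
def IsSesq {M : Type} [AddCommGroup M] [Module ℂ M] (φ : M → M → ℂ) : Prop :=
  (∀ a b c, φ (a + b) c = φ a c + φ b c) ∧
  (∀ (z : ℂ) (a b), φ (z • a) b = conj z * φ a b) ∧
  (∀ a b c, φ a (b + c) = φ a b + φ a c) ∧
  (∀ (z : ℂ) (a b), φ a (z • b) = z * φ a b)

/-- An inner product: a positive-definite Hermitian sesquilinear form. -/
def IsInnerProd {M : Type} [AddCommGroup M] [Module ℂ M] (φ : M → M → ℂ) : Prop :=
  IsSesq φ ∧ (∀ a b, conj (φ a b) = φ b a) ∧ (∀ a, a ≠ 0 → 0 < φ a a)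


lemma projOf_apply (F : Submodule ℂ H) (x : H) : projOf F x = F.starProjection x := rfl

lemma mem_projOf (F : Submodule ℂ H) (x : H) : projOf F x ∈ F := by
  rw [projOf_apply]
  exact Submodule.starProjection_apply_mem F x

lemma projOf_eq (F : Submodule ℂ H) (x : H) (hx : x ∈ F) : projOf F x = x := by
  rw [projOf_apply]
  exact Submodule.starProjection_eq_self_iff.2 hx

lemma projOf_symm (F : Submodule ℂ H) (x y : H) :
    ⟪x, projOf F y⟫_ℂ = ⟪projOf F x, y⟫_ℂ := by
  rw [projOf_apply, projOf_apply]
  exact (Submodule.inner_starProjection_left_eq_right F x y).symm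

lemma inner_projOf (F : Submodule ℂ H) (x y : H) (hx : x ∈ F) :
    ⟪x, projOf F y⟫_ℂ = ⟪x, y⟫_ℂ := by
  rw [projOf_symm, projOf_eq F x hx]

lemma ker_projOf (F : Submodule ℂ H) : LinearMap.ker (projOf F) = Fᗮ := by
  ext x
  rw [LinearMap.mem_ker, Submodule.mem_orthogonal]
  constructor
  · intro h u hu
    rw [← inner_projOf F u x hu, h, inner_zero_right]
  · intro h
    have := h _ (mem_projOf F x)
    rw [← inner_projOf F _ x (mem_projOf F x)] at this
    exact inner_self_eq_zero.1 this

lemma sa_mem (C : Submodule ℂ H) (ρ : H →ₗ[ℂ] H) (h : IsStateOn C ρ) (x : H) : ρ x ∈ C := by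
  apply h.2.2.2
  rw [supp, Submodule.mem_orthogonal]
  intro k hk
  rw [← h.1, LinearMap.adjoint_inner_right, LinearMap.mem_ker.1 hk, inner_zero_left]

lemma sa_inner (C : Submodule ℂ H) (ρ : H →ₗ[ℂ] H) (h : IsStateOn C ρ) (x y : H) :
    ⟪x, ρ y⟫_ℂ = ⟪ρ x, y⟫_ℂ := by
  conv_lhs => rw [← h.1]
  rw [LinearMap.adjoint_inner_right]

/-- rank one operator -/
def rk (u : H) : H →ₗ[ℂ] H := (innerₛₗ ℂ u).smulRight u

lemma rk_apply (u x : H) : rk u x = ⟪u, x⟫_ℂ • u := by simp [rk]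

lemma rk_trace (u : H) (T : H →ₗ[ℂ] H) :
    LinearMap.trace ℂ H (rk u ∘ₗ T) = ⟪u, T u⟫_ℂ := by
  have : rk u ∘ₗ T = ((innerₛₗ ℂ u) ∘ₗ T).smulRight u := by
    ext x; simp [rk]
  rw [this, LinearMap.trace_smulRight]
  simp

lemma rk_state (C : Submodule ℂ H) (u : H) (hu : u ∈ C) (h1 : ⟪u, u⟫_ℂ = 1) :
    IsStateOn C (rk u) := by
  refine ⟨?_, ?_, ?_, ?_⟩
  · symm
    rw [LinearMap.eq_adjoint_iff]
    intro x y
    rw [rk_apply, rk_apply, inner_smul_left, inner_smul_right, inner_conj_symm, mul_comm]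
  · intro x
    rw [rk_apply, inner_smul_right, ← inner_conj_symm u x, mul_comm, Complex.mul_conj]
    exact_mod_cast Complex.normSq_nonneg _
  · have := rk_trace u LinearMap.id
    rwa [LinearMap.comp_id, LinearMap.id_apply, h1] at this
  · rw [supp, ← Submodule.orthogonal_orthogonal C]
    apply Submodule.orthogonal_le
    intro x hx
    rw [LinearMap.mem_ker, rk_apply, (Submodule.mem_orthogonal _ _).1 hx u hu, zero_smul]

lemma exists_unit (C : Submodule ℂ H) (u : H) (hu : u ∈ C) (h0 : u ≠ 0) :
    ∃ e ∈ C, ⟪e, e⟫_ℂ = 1 ∧ ∃ a : ℂ, u = a • e := by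
  have hn : (‖u‖ : ℂ) ≠ 0 := by exact_mod_cast norm_ne_zero_iff.2 h0
  refine ⟨(‖u‖ : ℂ)⁻¹ • u, C.smul_mem _ hu, ?_, (‖u‖ : ℂ), ?_⟩
  · rw [inner_smul_left, inner_smul_right, inner_self_eq_norm_sq_to_K]
    simp only [map_inv₀, Complex.conj_ofReal, Complex.coe_algebraMap]
    field_simp
  · rw [smul_smul, mul_inv_cancel₀ hn, one_smul]

/-- **Theorem (properties of the `C`-decoding inner product).**
Let `φ` be an inner product on the noise subspace `𝒩`.  The five conditions of
Theorem 2.3 are equivalent. -/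
theorem decoding_inner_product_tfae
    (C : Submodule ℂ H) (hC : C ≠ ⊥)
    (𝒩 : Submodule ℂ (H →ₗ[ℂ] H)) (h𝒩 : 𝒩 ≠ ⊥)
    (φ : 𝒩 → 𝒩 → ℂ) (hφ : IsInnerProd φ) :
    List.TFAE
      [ -- (i) `φ` is the `C`-decoding inner product on `𝒩`
        ∀ η ρ : H →ₗ[ℂ] H, IsStateOn C η → IsStateOn C ρ → ∀ n m : 𝒩,
          η ∘ₗ (LinearMap.adjoint (n : H →ₗ[ℂ] H) ∘ₗ (m : H →ₗ[ℂ] H)) ∘ₗ ρ =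
            φ n m • (η ∘ₗ ρ),
        -- (ii) `⟪N u, M v⟫ = φ(N,M) ⟪u, v⟫` on `C`
        ∀ n m : 𝒩, ∀ u ∈ C, ∀ v ∈ C,
          ⟪(n : H →ₗ[ℂ] H) u, (m : H →ₗ[ℂ] H) v⟫_ℂ = φ n m * ⟪u, v⟫_ℂ,
        -- (iii) `φ(N,M) = tr (ρ N* M)` and `⟪N u, M v⟫ = 0` for `u ⊥ v`
        (∀ ρ : H →ₗ[ℂ] H, IsStateOn C ρ → ∀ n m : 𝒩,
            φ n m = LinearMap.trace ℂ H
              (ρ ∘ₗ LinearMap.adjoint (n : H →ₗ[ℂ] H) ∘ₗ (m : H →ₗ[ℂ] H))) ∧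
          (∀ n m : 𝒩, ∀ u ∈ C, ∀ v ∈ C, ⟪u, v⟫_ℂ = 0 →
            ⟪(n : H →ₗ[ℂ] H) u, (m : H →ₗ[ℂ] H) v⟫_ℂ = 0),
        -- (iv) `P_F N* M P_F = φ(N,M) P_F` for every subspace `F ≤ C`
        ∀ F : Submodule ℂ H, F ≤ C → ∀ n m : 𝒩,
          projOf F ∘ₗ (LinearMap.adjoint (n : H →ₗ[ℂ] H) ∘ₗ (m : H →ₗ[ℂ] H)) ∘ₗ projOf F =
            φ n m • projOf F,
        -- (v) `φ(N,N)^{-1/2} N P_F` is a partial isometry onto `F`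
        ∀ F : Submodule ℂ H, F ≤ C → ∀ n : 𝒩, n ≠ 0 →
          IsPartialIsometryOnto
            (((Real.sqrt (φ n n).re : ℂ))⁻¹ • ((n : H →ₗ[ℂ] H) ∘ₗ projOf F)) F ] := by
  tfae_have 1 → 2 := by
    intro h n m u hu v hv
    by_cases hu0 : u = 0
    · simp [hu0]
    by_cases hv0 : v = 0
    · simp [hv0]
    obtain ⟨e, he, he1, a, rfl⟩ := exists_unit C u hu hu0
    obtain ⟨f, hf, hf1, b, rfl⟩ := exists_unit C v hv hv0
    have key := congrArg (fun T : H →ₗ[ℂ] H => ⟪e, T f⟫_ℂ)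
      (h (rk e) (rk f) (rk_state C e he he1) (rk_state C f hf hf1) n m)
    simp only [LinearMap.comp_apply, LinearMap.smul_apply, rk_apply, hf1, one_smul,
      inner_smul_right, he1, mul_one, LinearMap.adjoint_inner_right] at key
    simp only [map_smul, inner_smul_left, inner_smul_right, key]
    ring
  tfae_have 2 → 1 := by
    intro h η ρ hη hρ n m
    ext y
    apply ext_inner_left ℂ
    intro x
    simp only [LinearMap.comp_apply, LinearMap.smul_apply, inner_smul_right]
    rw [sa_inner C η hη, sa_inner C η hη, LinearMap.adjoint_inner_right,
      h n m _ (sa_mem C η hη x) _ (sa_mem C ρ hρ y)]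
  tfae_have 2 → 4 := by
    intro h F hF n m
    ext y
    apply ext_inner_left ℂ
    intro x
    simp only [LinearMap.comp_apply, LinearMap.smul_apply, inner_smul_right]
    rw [projOf_symm, LinearMap.adjoint_inner_right,
      h n m _ (hF (mem_projOf F x)) _ (hF (mem_projOf F y)), inner_projOf F _ y (mem_projOf F x),
      projOf_symm]
  tfae_have 4 → 2 := by
    intro h n m u hu v hv
    have key := congrArg (fun T : H →ₗ[ℂ] H => ⟪u, T v⟫_ℂ) (h C le_rfl n m)
    simpa only [LinearMap.comp_apply, LinearMap.smul_apply, inner_smul_right, projOf_symm,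
      projOf_eq C u hu, projOf_eq C v hv, LinearMap.adjoint_inner_right] using key
  tfae_have 2 → 3 := by
    intro h
    refine ⟨?_, ?_⟩
    · intro ρ hρ n m
      set T := LinearMap.adjoint (n : H →ₗ[ℂ] H) ∘ₗ (m : H →ₗ[ℂ] H) with hT
      have e1 : projOf C ∘ₗ (ρ ∘ₗ T) = ρ ∘ₗ T := by
        ext x
        exact projOf_eq C _ (sa_mem C ρ hρ _)
      have e2 : (ρ ∘ₗ T) ∘ₗ projOf C = φ n m • ρ := by
        ext y
        apply ext_inner_left ℂ
        intro x
        simp only [hT, LinearMap.comp_apply, LinearMap.smul_apply, inner_smul_right]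
        rw [sa_inner C ρ hρ, sa_inner C ρ hρ, LinearMap.adjoint_inner_right,
          h n m _ (sa_mem C ρ hρ x) _ (mem_projOf C y), inner_projOf C _ _ (sa_mem C ρ hρ x)]
      rw [← e1, LinearMap.trace_comp_comm', e2, map_smul, hρ.2.2.1, smul_eq_mul, mul_one]
    · intro n m u hu v hv huv
      rw [h n m u hu v hv, huv, mul_zero]
  tfae_have 3 → 2 := by
    rintro ⟨h1, h2⟩ n m u hu v hv
    by_cases hu0 : u = 0
    · simp [hu0]
    obtain ⟨e, he, he1, a, rfl⟩ := exists_unit C u hu hu0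
    have k1 := h1 (rk e) (rk_state C e he he1) n m
    rw [rk_trace, LinearMap.comp_apply, LinearMap.adjoint_inner_right] at k1
    have k2 := h2 n m e he (v - ⟪e, v⟫_ℂ • e) (C.sub_mem hv (C.smul_mem _ he))
      (by rw [inner_sub_right, inner_smul_right, he1, mul_one, sub_self])
    rw [map_sub, map_smul, inner_sub_right, inner_smul_right, ← k1] at k2
    rw [map_smul, inner_smul_left, inner_smul_left, sub_eq_zero.1 k2]
    ring
  have hpos : ∀ n : 𝒩, n ≠ 0 → ((Real.sqrt (φ n n).re : ℂ)) ≠ 0 ∧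
      (Real.sqrt (φ n n).re : ℂ) * (Real.sqrt (φ n n).re : ℂ) = φ n n := by
    intro n hn
    obtain ⟨hr, hi⟩ := Complex.pos_iff.1 (hφ.2.2 n hn)
    refine ⟨by exact_mod_cast (Real.sqrt_pos.2 hr).ne', ?_⟩
    rw [← Complex.ofReal_mul, Real.mul_self_sqrt hr.le]
    exact Complex.ext (by simp) (by simpa using hi)
  tfae_have 2 → 5 := by
    intro h F hF n hn
    obtain ⟨hs, hss⟩ := hpos n hn
    set s : ℂ := (Real.sqrt (φ n n).re : ℂ) with hsd
    set V := s⁻¹ • ((n : H →ₗ[ℂ] H) ∘ₗ projOf F) with hV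
    have hsc : conj s = s := by rw [hsd, Complex.conj_ofReal]
    have hVV : LinearMap.adjoint V ∘ₗ V = projOf F := by
      ext y
      apply ext_inner_left ℂ
      intro x
      rw [LinearMap.comp_apply, LinearMap.adjoint_inner_right, hV]
      simp only [LinearMap.comp_apply, LinearMap.smul_apply, inner_smul_right, inner_smul_left]
      rw [h n n _ (hF (mem_projOf F x)) _ (hF (mem_projOf F y)),
        inner_projOf F _ y (mem_projOf F x), projOf_symm, map_inv₀, hsc, ← hss]
      field_simp
    have hsupp : supp V = F := by
      have : LinearMap.ker V = Fᗮ := by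
        rw [← ker_projOf, ← hVV]
        ext x
        simp only [LinearMap.mem_ker, LinearMap.comp_apply]
        constructor
        · intro hx
          rw [hx, map_zero]
        · intro hx
          have : ⟪x, LinearMap.adjoint V (V x)⟫_ℂ = 0 := by rw [hx, inner_zero_right]
          rw [LinearMap.adjoint_inner_right] at this
          exact inner_self_eq_zero.1 this
      rw [supp, this, Submodule.orthogonal_orthogonal]
    refine ⟨?_, hsupp⟩
    rw [IsPartialIsometry, hsupp, hVV]
  tfae_have 5 → 2 := by
    intro h
    obtain ⟨⟨ha1, hs1, ha2, hs2⟩, -, -⟩ := id hφ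
    have hd : ∀ n : 𝒩, ∀ u ∈ C, ∀ v ∈ C,
        ⟪(n : H →ₗ[ℂ] H) u, (n : H →ₗ[ℂ] H) v⟫_ℂ = φ n n * ⟪u, v⟫_ℂ := by
      intro n u hu v hv
      by_cases hn : n = 0
      · have := hs2 0 0 0
        rw [zero_smul, zero_mul] at this
        simp [hn, this]
      obtain ⟨hs, hss⟩ := hpos n hn
      obtain ⟨hi, hsu⟩ := h C le_rfl n hn
      rw [IsPartialIsometry, hsu] at hi
      have key := congrArg (fun T : H →ₗ[ℂ] H => ⟪u, T v⟫_ℂ) hi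
      simp only [LinearMap.comp_apply, LinearMap.smul_apply, LinearMap.adjoint_inner_right,
        inner_smul_right, inner_smul_left, projOf_eq C u hu, projOf_eq C v hv,
        map_inv₀, Complex.conj_ofReal] at key
      generalize (Real.sqrt (φ n n).re : ℂ) = s at hs hss key
      rw [← key, ← hss]
      field_simp
    intro n m u hu v hv
    have e1 := hd (n + m) u hu v hv
    have e2 := hd (n + Complex.I • m) u hu v hv
    have e3 := hd n u hu v hv
    have e4 := hd m u hu v hv
    simp only [Submodule.coe_add, Submodule.coe_smul, LinearMap.add_apply, LinearMap.smul_apply,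
      inner_add_left, inner_add_right, inner_smul_left, inner_smul_right, ha1, ha2, hs1, hs2,
      Complex.conj_I, e3, e4] at e1 e2
    have hI := Complex.I_mul_I
    linear_combination (1/2 : ℂ) * e1 - (1/2 : ℂ) * Complex.I * e2 +
      (1/2 : ℂ) * ((⟪(n : H →ₗ[ℂ] H) u, (m : H →ₗ[ℂ] H) v⟫_ℂ - φ n m * ⟪u, v⟫_ℂ)
        - (⟪(m : H →ₗ[ℂ] H) u, (n : H →ₗ[ℂ] H) v⟫_ℂ - φ m n * ⟪u, v⟫_ℂ)) * hI
  tfae_finish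
end
end

section
/- Let H = H₁ ⊕ ⋯ ⊕ H_k be an orthogonal decomposition of H into nonzero subspaces, let 𝒞_s ⊆ H_s be codes, and for s = 1,…,k and j = 1,…,n let N_{sj} ∈ B(H) be operators with N_{sj} = P_{H_s} N_{sj} P_{H_s} (i.e., N_{sj} acts on the block H_s). Then {N_{sj}}_{j=1}^{n} is a 𝒞_s-decoding noise basis of 𝒩_s := span{N_{sj} : j = 1,…,n} for every s = 1,…,k, if and only if the family {Σ_{s=1}^k N_{sj}}_{j=1}^{n} (the blockwise direct sums ⊕_{s=1}^k N_{sj}) is a (𝒞₁ ⊕ ⋯ ⊕ 𝒞_k)-decoding noise basis of its span. -/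
open scoped InnerProductSpace ComplexConjugate ComplexOrder
open LinearMap Submodule

noncomputable section

variable {H : Type} [NormedAddCommGroup H] [InnerProductSpace ℂ H] [FiniteDimensional ℂ H]

/-- The rank-one operator `|u⟩⟨v| : f ↦ ⟪v, f⟫ u`. -/
def ketBra (u v : H) : H →ₗ[ℂ] H := (innerₛₗ ℂ v).smulRight u

/-- A family `{N_j}` is a `C`-decoding noise basis (of its span). -/
def IsDecodingNoiseBasis (C : Submodule ℂ H) {ι : Type} (Nb : ι → (H →ₗ[ℂ] H)) : Prop :=
  LinearIndependent ℂ Nb ∧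
  (∀ j, IsPartialIsometryOnto (Nb j ∘ₗ projOf C) C) ∧
  ∀ j k, j ≠ k → ∀ u ∈ C, ∀ v ∈ C, ⟪Nb j u, Nb k v⟫_ℂ = 0

theorem projOf_of_mem (C : Submodule ℂ H) {u : H} (hu : u ∈ C) : projOf C u = u := by
  simpa [projOf] using Submodule.starProjection_eq_self_iff.2 hu

theorem projOf_mem (C : Submodule ℂ H) (u : H) : projOf C u ∈ C := by
  simp [projOf]

theorem projOf_inner (C : Submodule ℂ H) (u v : H) : ⟪projOf C u, v⟫_ℂ = ⟪u, projOf C v⟫_ℂ :=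
  Submodule.inner_starProjection_left_eq_right C u v

theorem projOf_eq_zero_iff (C : Submodule ℂ H) (u : H) : projOf C u = 0 ↔ u ∈ Cᗮ := by
  constructor
  · intro h
    rw [Submodule.mem_orthogonal]
    intro v hv
    rw [← projOf_of_mem C hv, projOf_inner, h, inner_zero_right]
  · intro h
    rw [← inner_self_eq_zero (𝕜 := ℂ), projOf_inner, projOf_of_mem C (projOf_mem C u)]
    exact (Submodule.mem_orthogonal' C u).1 h _ (projOf_mem C u)

theorem pio_iff (C : Submodule ℂ H) (A : H →ₗ[ℂ] H) :
    IsPartialIsometryOnto (A ∘ₗ projOf C) C ↔ ∀ u ∈ C, ∀ v ∈ C, ⟪A u, A v⟫_ℂ = ⟪u, v⟫_ℂ := by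
  constructor
  · rintro ⟨h1, h2⟩ u hu v hv
    unfold IsPartialIsometry at h1
    rw [h2] at h1
    have h3 := congrArg (fun T : H →ₗ[ℂ] H => ⟪u, T v⟫_ℂ) h1
    simp only [LinearMap.comp_apply, projOf_of_mem C hv] at h3
    rw [← h3, LinearMap.adjoint_inner_right, LinearMap.comp_apply, projOf_of_mem C hu]
  · intro h
    have hs : supp (A ∘ₗ projOf C) = C := by
      have : LinearMap.ker (A ∘ₗ projOf C) = Cᗮ := by
        ext x
        rw [LinearMap.mem_ker, LinearMap.comp_apply, ← projOf_eq_zero_iff]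
        constructor
        · intro hx
          rw [← inner_self_eq_zero (𝕜 := ℂ), ← h _ (projOf_mem C x) _ (projOf_mem C x), hx,
            inner_zero_right]
        · intro hx
          rw [hx, map_zero]
      rw [supp, this, Submodule.orthogonal_orthogonal]
    refine ⟨?_, hs⟩
    unfold IsPartialIsometry
    rw [hs]
    ext v
    refine ext_inner_left ℂ fun u => ?_
    rw [LinearMap.comp_apply, LinearMap.adjoint_inner_right, LinearMap.comp_apply,
      LinearMap.comp_apply, h _ (projOf_mem C u) _ (projOf_mem C v), projOf_inner,
      projOf_of_mem C (projOf_mem C v)]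

theorem dnb_iff (C : Submodule ℂ H) (hC : C ≠ ⊥) {n : ℕ} (A : Fin n → (H →ₗ[ℂ] H)) :
    IsDecodingNoiseBasis C A ↔
      ∀ i j, ∀ u ∈ C, ∀ v ∈ C, ⟪A i u, A j v⟫_ℂ = if i = j then ⟪u, v⟫_ℂ else 0 := by
  constructor
  · rintro ⟨-, h1, h2⟩ i j u hu v hv
    split_ifs with hij
    · subst hij
      exact (pio_iff C _).1 (h1 i) u hu v hv
    · exact h2 i j hij u hu v hv
  · intro h
    refine ⟨?_, fun j => (pio_iff C _).2 fun u hu v hv => by simpa using h j j u hu v hv,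
      fun i j hij u hu v hv => by simpa [hij] using h i j u hu v hv⟩
    obtain ⟨u, hu, hu0⟩ := Submodule.exists_mem_ne_zero_of_ne_bot hC
    rw [Fintype.linearIndependent_iff]
    intro c hc i
    have h3 := congrArg (fun T : H →ₗ[ℂ] H => ⟪A i u, T u⟫_ℂ) hc
    simp only [LinearMap.sum_apply, LinearMap.smul_apply, inner_sum, inner_smul_right,
      LinearMap.zero_apply, inner_zero_right, h i _ u hu u hu] at h3
    simpa [hu0] using h3

/-- **Proposition 5.2.**  For an orthogonal decomposition `H = H₁ ⊕ ⋯ ⊕ H_k`, codes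
`C_s ≤ H_s` and blockwise operators `N_{sj} = P_{H_s} N_{sj} P_{H_s}`, the families
`{N_{sj}}_j` are `C_s`-decoding noise bases for every `s` if and only if the blockwise
direct sums `{⊕_s N_{sj}}_j` form a `(⊕_s C_s)`-decoding noise basis. -/
theorem blockwise_decoding_basis
    (k n : ℕ) (hk : 1 ≤ k) (hn : 1 ≤ n)
    (Hs : Fin k → Submodule ℂ H)
    (hHne : ∀ s, Hs s ≠ ⊥)
    (hHorth : ∀ s s' : Fin k, s ≠ s' → ∀ x ∈ Hs s, ∀ y ∈ Hs s', ⟪x, y⟫_ℂ = 0)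
    (hHtop : (⨆ s, Hs s) = (⊤ : Submodule ℂ H))
    (Cs : Fin k → Submodule ℂ H)
    (hCle : ∀ s, Cs s ≤ Hs s) (hCne : ∀ s, Cs s ≠ ⊥)
    (N : Fin k → Fin n → (H →ₗ[ℂ] H))
    (hblock : ∀ s j, N s j = projOf (Hs s) ∘ₗ N s j ∘ₗ projOf (Hs s)) :
    (∀ s, IsDecodingNoiseBasis (Cs s) (N s)) ↔
      IsDecodingNoiseBasis (⨆ s, Cs s) (fun j => ∑ s, N s j) := by
  have hne : (⨆ s, Cs s) ≠ ⊥ := fun h =>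
    hCne ⟨0, hk⟩ (le_bot_iff.1 (h ▸ le_iSup Cs ⟨0, hk⟩))
  rw [dnb_iff _ hne, forall_congr' fun s => dnb_iff (Cs s) (hCne s) (N s)]
  have hmem : ∀ s j x, N s j x ∈ Hs s := by
    intro s j x
    rw [hblock s j]
    exact projOf_mem _ _
  have hsum : ∀ s, ∀ u ∈ Cs s, ∀ j, (∑ t, N t j) u = N s j u := by
    intro s u hu j
    rw [LinearMap.sum_apply]
    refine Finset.sum_eq_single s (fun t _ hts => ?_) (by simp)
    have h0 : projOf (Hs t) u = 0 := by
      rw [projOf_eq_zero_iff, Submodule.mem_orthogonal]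
      exact fun y hy => hHorth t s hts y hy u (hCle s hu)
    rw [hblock t j, LinearMap.comp_apply, LinearMap.comp_apply, h0, map_zero, map_zero]
  constructor
  · intro h i j u hu v hv
    induction hu using Submodule.iSup_induction' with
    | zero => simp
    | add x y _ _ hx hy =>
      rw [map_add, inner_add_left, inner_add_left, hx, hy]
      split_ifs <;> simp
    | mem s u hu =>
      induction hv using Submodule.iSup_induction' with
      | zero => simp
      | add x y _ _ hx hy =>
        rw [map_add, inner_add_right, inner_add_right, hx, hy]
        split_ifs <;> simp
      | mem t v hv =>
        rw [hsum s u hu, hsum t v hv]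
        by_cases hst : s = t
        · subst hst
          exact h s i j u hu v hv
        · rw [hHorth s t hst _ (hmem s i u) _ (hmem t j v),
            hHorth s t hst u (hCle s hu) v (hCle t hv), ite_self]
  · intro h s i j u hu v hv
    rw [← hsum s u hu, ← hsum s v hv]
    exact h i j u (le_iSup Cs s hu) v (le_iSup Cs s hv)
end
end
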